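/- arXiv:0811.0402 — 3 statements merged into one kernel-verified Lean document; each statement's English description precedes it below -/
import Mathlib

section
/- Let n ≥ 2 and let M be an (n+1)×(n+1) matrix over a commutative ring R whose last row equals the transpose of its last column, and assume that I_{n−1} does not lie in the ideal of R generated by I_n. Then I_{n−1}·G_n − Li_n·Li'_n lies in the ideal of R generated by I_n, i.e. I_{n−1}·G_n ≡ Li_n·Li'_n (mod I_n). -/
open Matrix

/-- The strictly monotone map `Fin (m-1) → Fin m` whose image avoids exactly the value `i`. -/
def skipAt {m : ℕ} (i : Fin m) (x : Fin (m-1)) : Fin m :=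
  if (x : ℕ) < (i : ℕ) then ⟨(x : ℕ), by have := x.isLt; omega⟩
  else ⟨(x : ℕ) + 1, by have := x.isLt; omega⟩

/-- The top-left `n × n` block `A` of an `(n+1) × (n+1)` matrix `M`;
its determinant is `I_n`. -/
def topSq {R : Type*} [CommRing R] {n : ℕ} (M : Matrix (Fin (n+1)) (Fin (n+1)) R) :
    Matrix (Fin n) (Fin n) R :=
  M.submatrix Fin.castSucc Fin.castSucc

/-- The border entries `a_i := M_{i,n}` for `0 ≤ i ≤ n-1`. -/
def borderCoeff {R : Type*} [CommRing R] {n : ℕ} (M : Matrix (Fin (n+1)) (Fin (n+1)) R)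
    (i : Fin n) : R :=
  M i.castSucc (Fin.last n)

/-- `I_{n-1}`: the determinant of the top-left `(n-1) × (n-1)` block of `M`. -/
def Iprev {R : Type*} [CommRing R] {n : ℕ} (M : Matrix (Fin (n+1)) (Fin (n+1)) R) : R :=
  (M.submatrix (fun x : Fin (n-1) => (⟨(x : ℕ), by have := x.isLt; omega⟩ : Fin (n+1)))
     (fun x : Fin (n-1) => (⟨(x : ℕ), by have := x.isLt; omega⟩ : Fin (n+1)))).det

/-- The inclusion `Fin (n-1) → Fin n`. -/
def finCastPred {n : ℕ} (i : Fin (n-1)) : Fin n := ⟨(i : ℕ), by have := i.isLt; omega⟩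

/-- `G_n := Σ_{0 ≤ i,j ≤ n-1} (-1)^{i+j} a_i a_j I_n(i;j)`, where `I_n(i;j)` is the
determinant of the top-left `n × n` block with row `i` and column `j` deleted. -/
def Gpoly {R : Type*} [CommRing R] {n : ℕ} (M : Matrix (Fin (n+1)) (Fin (n+1)) R) : R :=
  ∑ i : Fin n, ∑ j : Fin n, (-1 : R) ^ ((i : ℕ) + (j : ℕ))
    * borderCoeff M i * borderCoeff M j
    * ((topSq M).submatrix (skipAt i) (skipAt j)).det

/-- `Li_n := a_{n-1} I_{n-1} + Σ_{i=0}^{n-2} (-1)^{i+n-1} a_i I_n(i;n-1)`. -/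
def LiL {R : Type*} [CommRing R] {n : ℕ} (M : Matrix (Fin (n+1)) (Fin (n+1)) R)
    (hn : 1 ≤ n) : R :=
  borderCoeff M ⟨n-1, by omega⟩ * Iprev M
    + ∑ i : Fin (n-1), (-1 : R) ^ ((i : ℕ) + (n-1))
        * borderCoeff M (finCastPred i)
        * ((topSq M).submatrix (skipAt (finCastPred i)) (skipAt (⟨n-1, by omega⟩ : Fin n))).det

/-- `Li'_n := a_{n-1} I_{n-1} + Σ_{j=0}^{n-2} (-1)^{j+n-1} a_j I_n(n-1;j)`. -/
def LiR {R : Type*} [CommRing R] {n : ℕ} (M : Matrix (Fin (n+1)) (Fin (n+1)) R)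
    (hn : 1 ≤ n) : R :=
  borderCoeff M ⟨n-1, by omega⟩ * Iprev M
    + ∑ j : Fin (n-1), (-1 : R) ^ ((j : ℕ) + (n-1))
        * borderCoeff M (finCastPred j)
        * ((topSq M).submatrix (skipAt (⟨n-1, by omega⟩ : Fin n)) (skipAt (finCastPred j))).det

theorem map_add_submatrix_one_mul_submatrix_one {ι κ S T : Type*} [Fintype κ] [DecidableEq ι]
    [CommRing S] [CommRing T] (f : S →+* T) (B : Matrix ι ι S) (r c : κ → ι) :
    (B + (1 : Matrix ι ι S).submatrix id c * (1 : Matrix ι ι S).submatrix r id).map f =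
      B.map f + (1 : Matrix ι ι T).submatrix id c * (1 : Matrix ι ι T).submatrix r id := by
  rw [Matrix.map_add f (map_add f), Matrix.map_mul, ← Matrix.submatrix_map, ← Matrix.submatrix_map,
    Matrix.map_one f (map_zero f) (map_one f)]

theorem det_mul_det_add_submatrix_one_of_field {ι K : Type*} [Fintype ι] [DecidableEq ι] [Field K]
    (B : Matrix ι ι K) (hB : B.det ≠ 0) (r c : Fin 2 → ι) :
    B.det * (B + (1 : Matrix ι ι K).submatrix id c *
        (1 : Matrix ι ι K).submatrix r id).det =
      (B.det + B.adjugate (r 0) (c 0)) * (B.det + B.adjugate (r 1) (c 1)) -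
        B.adjugate (r 0) (c 1) * B.adjugate (r 1) (c 0) := by
  have hsub : (1 : Matrix ι ι K).submatrix r id * B⁻¹ *
      (1 : Matrix ι ι K).submatrix id c = B⁻¹.submatrix r c := by
    ext a b
    simp only [Matrix.mul_apply, Matrix.submatrix_apply, Matrix.one_apply, id, ite_mul, one_mul,
      zero_mul, mul_ite, mul_one, mul_zero, Finset.sum_ite_eq, Finset.sum_ite_eq', Finset.mem_univ,
      if_true]
  rw [Matrix.det_add_mul _ _ (isUnit_iff_ne_zero.mpr hB), hsub, Matrix.det_fin_two]
  simp only [Matrix.inv_def, Ring.inverse_eq_inv', Matrix.add_apply, Matrix.submatrix_apply,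
    Matrix.smul_apply, smul_eq_mul, Matrix.one_apply_eq, Matrix.one_apply_ne (zero_ne_one' (Fin 2)),
    Matrix.one_apply_ne (one_ne_zero' (Fin 2)), zero_add]
  field_simp

/-- The ones added to `A` in positions `(c 0, r 0)` and `(c 1, r 1)` make the determinant expand
into a `2 × 2` minor of the adjugate, up to multiples of `A.det`. -/
theorem det_mul_det_add_submatrix_one {ι R : Type*} [Fintype ι] [DecidableEq ι] [CommRing R]
    (A : Matrix ι ι R) (r c : Fin 2 → ι) :
    A.det * (A + (1 : Matrix ι ι R).submatrix id c *
        (1 : Matrix ι ι R).submatrix r id).det =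
      (A.det + A.adjugate (r 0) (c 0)) * (A.det + A.adjugate (r 1) (c 1)) -
        A.adjugate (r 0) (c 1) * A.adjugate (r 1) (c 0) := by
  let P := MvPolynomial (ι × ι) ℤ
  let X : Matrix ι ι P := Matrix.mvPolynomialX ι ι ℤ
  have hX : X.det * (X + (1 : Matrix ι ι P).submatrix id c *
        (1 : Matrix ι ι P).submatrix r id).det =
      (X.det + X.adjugate (r 0) (c 0)) * (X.det + X.adjugate (r 1) (c 1)) -
        X.adjugate (r 0) (c 1) * X.adjugate (r 1) (c 0) := by
    let g := algebraMap P (FractionRing P)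
    have hadj (a b : ι) : g (X.adjugate a b) = (X.map g).adjugate a b :=
      congrFun₂ (g.map_adjugate X) a b
    apply IsFractionRing.injective P (FractionRing P)
    have hdet : (X.map g).det ≠ 0 := by
      rw [← RingHom.mapMatrix_apply, ← RingHom.map_det]
      exact (map_ne_zero_iff _ (IsFractionRing.injective P (FractionRing P))).mpr
        (Matrix.det_mvPolynomialX_ne_zero ι ℤ)
    have h := det_mul_det_add_submatrix_one_of_field (X.map g) hdet r c
    rw [← map_add_submatrix_one_mul_submatrix_one] at h
    rw [← hadj, ← hadj, ← hadj, ← hadj, ← RingHom.mapMatrix_apply, ← RingHom.mapMatrix_apply,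
      ← RingHom.map_det, ← RingHom.map_det] at h
    simpa only [g, map_sub, map_mul, map_add] using h
  let f : P →+* R := MvPolynomial.eval₂Hom (Int.castRingHom R) fun x => A x.1 x.2
  have hA : X.map f = A := by
    ext a b
    exact MvPolynomial.eval₂_X _ _ _
  have hadj (a b : ι) : f (X.adjugate a b) = A.adjugate a b := by
    rw [← hA]
    exact congrFun₂ (f.map_adjugate X) a b
  have h := congrArg f hX
  rwa [map_sub, map_mul, map_mul, map_mul, map_add, map_add, RingHom.map_det, RingHom.map_det,
    RingHom.mapMatrix_apply, RingHom.mapMatrix_apply, map_add_submatrix_one_mul_submatrix_one,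
    hA, hadj, hadj, hadj, hadj] at h

theorem adjugate_minor_mem_span_det {ι R : Type*} [Fintype ι] [DecidableEq ι] [CommRing R]
    (A : Matrix ι ι R) (p q i k : ι) :
    A.adjugate p i * A.adjugate q k - A.adjugate p k * A.adjugate q i ∈
      Ideal.span {A.det} := by
  rw [Ideal.mem_span_singleton]
  refine ⟨(A + (1 : Matrix ι ι R).submatrix id ![i, k] *
    (1 : Matrix ι ι R).submatrix ![p, q] id).det - A.det - A.adjugate p i - A.adjugate q k, ?_⟩
  have h := det_mul_det_add_submatrix_one A ![p, q] ![i, k]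
  simp only [Matrix.cons_val_zero, Matrix.cons_val_one] at h
  linear_combination -h

theorem skipAt_eq_succAbove {m : ℕ} (i : Fin (m + 1)) :
    (skipAt i : Fin m → Fin (m + 1)) = i.succAbove := by
  funext x
  simp only [skipAt, Fin.succAbove, Fin.lt_def, Fin.val_castSucc]
  split_ifs <;> rfl

theorem neg_one_pow_mul_mul_cancel {R : Type*} [CommRing R] (k : ℕ) (a b : R) :
    (-1) ^ k * a * ((-1) ^ k * b) = a * b := by
  have h : ((-1 : R) ^ k) * (-1) ^ k = 1 := by rw [← pow_add, Even.neg_one_pow ⟨_, rfl⟩]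
  linear_combination a * b * h

section Adjugate

variable {R : Type*} [CommRing R] {m : ℕ} (M : Matrix (Fin (m + 1 + 1)) (Fin (m + 1 + 1)) R)

theorem det_submatrix_skipAt (A : Matrix (Fin (m + 1)) (Fin (m + 1)) R) (i j : Fin (m + 1)) :
    (A.submatrix (skipAt i) (skipAt j)).det = (-1) ^ ((i : ℕ) + j) * A.adjugate j i := by
  rw [Matrix.adjugate_fin_succ_eq_det_submatrix, ← mul_assoc, ← pow_add,
    Even.neg_one_pow ⟨_, rfl⟩, one_mul, skipAt_eq_succAbove, skipAt_eq_succAbove]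

theorem Iprev_eq_adjugate :
    Iprev M = (topSq M).adjugate (Fin.last m) (Fin.last m) := by
  rw [Matrix.adjugate_fin_succ_eq_det_submatrix, Even.neg_one_pow ⟨_, rfl⟩, one_mul,
    Fin.succAbove_last]
  rfl

theorem Gpoly_eq_sum_adjugate :
    Gpoly M = ∑ i, ∑ j, borderCoeff M i * borderCoeff M j * (topSq M).adjugate j i := by
  refine Finset.sum_congr rfl fun i _ => Finset.sum_congr rfl fun j _ => ?_
  rw [det_submatrix_skipAt, mul_assoc ((-1 : R) ^ _), neg_one_pow_mul_mul_cancel]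

theorem LiL_eq_sum_adjugate (h : 1 ≤ m + 1) :
    LiL M h = ∑ i, borderCoeff M i * (topSq M).adjugate (Fin.last m) i := by
  rw [Fin.sum_univ_castSucc, LiL, Iprev_eq_adjugate, add_comm]
  refine congrArg₂ _ (Finset.sum_congr rfl fun i _ => ?_) rfl
  rw [det_submatrix_skipAt]
  exact neg_one_pow_mul_mul_cancel _ _ _

theorem LiR_eq_sum_adjugate (h : 1 ≤ m + 1) :
    LiR M h = ∑ j, borderCoeff M j * (topSq M).adjugate j (Fin.last m) := by
  rw [Fin.sum_univ_castSucc, LiR, Iprev_eq_adjugate, add_comm]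
  refine congrArg₂ _ (Finset.sum_congr rfl fun j _ => ?_) rfl
  rw [det_submatrix_skipAt, add_comm]
  exact neg_one_pow_mul_mul_cancel _ _ _

end Adjugate

/-- Theorem 1.3: if `I_{n-1} ≢ 0 (mod I_n)`, then
`I_{n-1}·G_n ≡ Li_n·Li'_n (mod I_n)`. -/
theorem Iprev_mul_Gpoly_congr {R : Type*} [CommRing R] {n : ℕ} (hn : 2 ≤ n)
    (M : Matrix (Fin (n+1)) (Fin (n+1)) R)
    (hsym : ∀ i, M (Fin.last n) i = M i (Fin.last n))
    (hmem : Iprev M ∉ Ideal.span {(topSq M).det}) :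
    Iprev M * Gpoly M - LiL M (by omega) * LiR M (by omega)
      ∈ Ideal.span {(topSq M).det} := by
  obtain ⟨m, rfl⟩ : ∃ m, n = m + 1 := ⟨n - 1, by omega⟩
  rw [Iprev_eq_adjugate, Gpoly_eq_sum_adjugate, LiL_eq_sum_adjugate, LiR_eq_sum_adjugate,
    Finset.sum_mul_sum, Finset.mul_sum, ← Finset.sum_sub_distrib]
  refine Ideal.sum_mem _ fun i _ => ?_
  rw [Finset.mul_sum, ← Finset.sum_sub_distrib]
  refine Ideal.sum_mem _ fun j _ => ?_
  convert Ideal.mul_mem_left _ (borderCoeff M i * borderCoeff M j)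
    (adjugate_minor_mem_span_det (topSq M) (Fin.last m) j (Fin.last m) i) using 1
  ring
end

section
/- Let Γ be a finite connected directed multigraph and let h₁,…,h_r be a ℤ-basis of H₁(Γ,ℤ). Then every coefficient of the graph polynomial Ψ_Γ = det( Σ_{e∈E} A_e·M_e ) ∈ ℤ[A_e : e ∈ E] is either 0 or 1. -/
open MvPolynomial

/-- The boundary map `∂ : ℤ[E] → ℤ[V]` of a directed multigraph with source map `s`
and target map `t`: the basis vector of an edge `e` is sent to `s(e) − t(e)`. -/
def graphBoundary {E V : Type*} [Fintype E] [DecidableEq V] (s t : E → V)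
    (f : E → ℤ) : V → ℤ :=
  fun v => ∑ e : E, f e * ((if s e = v then 1 else 0) - (if t e = v then 1 else 0))

/-- Two vertices are joined by an edge of `T` (traversed in either direction). -/
def EdgeStep {E V : Type*} (s t : E → V) (T : Finset E) (a b : V) : Prop :=
  ∃ e ∈ T, (s e = a ∧ t e = b) ∨ (s e = b ∧ t e = a)

/-- `T` is a spanning tree of the connected multigraph `(V, E, s, t)`:
`|T| = |V| − 1` and the multigraph `(V, T)` is connected. -/
def IsSpanningTree {E V : Type*} [Fintype E] [Fintype V] (s t : E → V)
    (T : Finset E) : Prop :=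
  T.card + 1 = Fintype.card V ∧
    ∀ u v : V, Relation.ReflTransGen (EdgeStep s t T) u v

/-- The graph polynomial `Ψ_Γ = det(Σ_e A_e M_e) ∈ ℤ[A_e : e ∈ E]`, where `h` is a
`ℤ`-basis of `H₁(Γ,ℤ)` and `(M_e)_{ij} = (h_i)_e (h_j)_e`. -/
noncomputable def graphPoly {E : Type*} [Fintype E] {r : ℕ} (h : Fin r → (E → ℤ)) :
    MvPolynomial E ℤ :=
  (Matrix.of fun i j : Fin r => ∑ e : E, X e * C (h i e * h j e)).det

theorem graphBoundary_add {E V : Type*} [Fintype E] [DecidableEq V] (s t : E → V)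
    (f g : E → ℤ) :
    graphBoundary s t (f + g) = graphBoundary s t f + graphBoundary s t g := by
  funext v
  simp [graphBoundary, add_mul, Finset.sum_add_distrib]

theorem graphBoundary_smul {E V : Type*} [Fintype E] [DecidableEq V] (s t : E → V)
    (c : ℤ) (f : E → ℤ) : graphBoundary s t (c • f) = c • graphBoundary s t f := by
  funext v
  simp [graphBoundary, Finset.mul_sum, mul_assoc]

theorem graphBoundary_sum_smul {E V ι : Type*} [Fintype E] [Fintype ι] [DecidableEq V]
    (s t : E → V) (c : ι → ℤ) (h : ι → E → ℤ) (hker : ∀ i, graphBoundary s t (h i) = 0) :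
    graphBoundary s t (∑ i, c i • h i) = 0 := by
  refine Finset.sum_induction _ (fun f => graphBoundary s t f = 0) ?_ ?_ ?_
  · intro f g hf hg
    rw [graphBoundary_add, hf, hg, add_zero]
  · funext v
    simp [graphBoundary]
  · intro i _
    rw [graphBoundary_smul, hker, smul_zero]

theorem graphBoundary_single {E V : Type*} [Fintype E] [DecidableEq E] [DecidableEq V]
    (s t : E → V) (e : E) (c : ℤ) :
    graphBoundary s t (Pi.single e c) = Pi.single (s e) c - Pi.single (t e) c := by
  funext v
  rw [graphBoundary, Finset.sum_eq_single e]
  · simp [Pi.single_apply, mul_sub, eq_comm]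
  · intro b _ hb
    simp [hb]
  · simp

/-- A walk in `T` carries a unit flow supported on `T`. -/
theorem exists_flow_of_reflTransGen {E V : Type*} [Fintype E] [DecidableEq E] [DecidableEq V]
    (s t : E → V) (T : Finset E) {a b : V}
    (hab : Relation.ReflTransGen (EdgeStep s t T) a b) :
    ∃ g : E → ℤ, (∀ e ∉ T, g e = 0) ∧
      graphBoundary s t g = Pi.single a 1 - Pi.single b 1 := by
  induction hab with
  | refl => exact ⟨0, fun _ _ => rfl, by funext v; simp [graphBoundary]⟩
  | tail _ hstep ih =>
    obtain ⟨g, hg, hgb⟩ := ih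
    obtain ⟨e, he, h⟩ := hstep
    have key : ∀ c : ℤ, ∀ x ∉ T, (g + Pi.single e c : E → ℤ) x = 0 := by
      intro c x hx
      have hne : x ≠ e := fun hxe => hx (hxe ▸ he)
      simp [hg x hx, hne]
    rcases h with ⟨rfl, rfl⟩ | ⟨rfl, rfl⟩
    · refine ⟨g + Pi.single e 1, key 1, ?_⟩
      rw [graphBoundary_add, hgb, graphBoundary_single]
      abel
    · refine ⟨g + Pi.single e (-1), key (-1), ?_⟩
      rw [graphBoundary_add, hgb, graphBoundary_single, Pi.single_neg, Pi.single_neg]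
      abel

/-- The net flow of a cycle through any cut vanishes. -/
theorem sum_cut_eq_zero {E V : Type*} [Fintype E] [Fintype V] [DecidableEq V]
    (s t : E → V) (f : E → ℤ) (hf : graphBoundary s t f = 0)
    (P : V → Prop) [DecidablePred P] :
    ∑ e, f e * ((if P (s e) then 1 else 0) - (if P (t e) then 1 else 0)) = 0 := by
  have h0 : ∑ v, graphBoundary s t f v * (if P v then 1 else 0) = 0 := by simp [hf]
  refine Eq.trans ?_ h0
  simp only [graphBoundary, Finset.sum_mul]
  rw [Finset.sum_comm]
  refine Finset.sum_congr rfl fun e _ => ?_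
  simp only [mul_assoc]
  rw [← Finset.mul_sum]
  congr 1
  simp only [sub_mul, Finset.sum_sub_distrib, ite_mul, one_mul, zero_mul, Finset.sum_ite_eq,
    Finset.mem_univ, if_true]

/-- If some cycle meets the complement of `T` exactly in the edge `e`, then the endpoints of `e`
are joined by a walk in `T`. -/
theorem reflTransGen_of_cycle {E V : Type*} [Fintype E] [Fintype V] [DecidableEq V]
    (s t : E → V) (T : Finset E) (f : E → ℤ) (hf : graphBoundary s t f = 0)
    (e : E) (he : f e ≠ 0) (hT : ∀ x ∉ T, x ≠ e → f x = 0) :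
    Relation.ReflTransGen (EdgeStep s t T) (t e) (s e) := by
  classical
  by_contra hcon
  have hcut := sum_cut_eq_zero s t f hf (Relation.ReflTransGen (EdgeStep s t T) (t e))
  rw [Finset.sum_eq_single e] at hcut
  · simp [hcon, Relation.ReflTransGen.refl, he] at hcut
  · intro x _ hx
    by_cases hxT : x ∈ T
    · have hiff : Relation.ReflTransGen (EdgeStep s t T) (t e) (s x) ↔
          Relation.ReflTransGen (EdgeStep s t T) (t e) (t x) :=
        ⟨fun h => h.tail ⟨x, hxT, Or.inl ⟨rfl, rfl⟩⟩,
          fun h => h.tail ⟨x, hxT, Or.inr ⟨rfl, rfl⟩⟩⟩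
      simp [hiff]
    · simp [hT x hxT hx]
  · simp

/-- The maximal minors of the matrix of a generating family of cycles are `0` or units. -/
theorem det_cycles_eq_zero_or_isUnit {E V : Type*} [Fintype E] [Fintype V] [DecidableEq E]
    [DecidableEq V] (s t : E → V) {r : ℕ} (h : Fin r → (E → ℤ))
    (hker : ∀ i, graphBoundary s t (h i) = 0)
    (hspan : ∀ f : E → ℤ, graphBoundary s t f = 0 → f ∈ Submodule.span ℤ (Set.range h))
    (φ : Fin r → E) (hφ : Function.Injective φ) :
    (Matrix.of fun i j => h i (φ j)).det = 0 ∨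
      IsUnit (Matrix.of fun i j => h i (φ j)).det := by
  set M : Matrix (Fin r) (Fin r) ℤ := Matrix.of fun i j => h i (φ j) with hM
  refine or_iff_not_imp_left.2 fun hdet => ?_
  let T : Finset E := (Finset.univ.image φ)ᶜ
  have hT : ∀ x ∉ T, ∃ j, φ j = x := by
    intro x hx
    simpa [T] using hx
  have hφT : ∀ j, φ j ∉ T := by
    intro j
    simp [T]
  have hcycle : ∀ i, ∃ c : Fin r → ℤ,
      ∀ j, ∑ k, c k * M k j = (1 : Matrix (Fin r) (Fin r) ℤ) i j := by
    intro i
    have hval : ∀ j, (∑ k, M.adjugate i k • h k) (φ j) =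
        M.det * (1 : Matrix (Fin r) (Fin r) ℤ) i j := by
      intro j
      have := congrFun (congrFun M.adjugate_mul i) j
      simpa [Matrix.mul_apply, hM] using this
    have hwalk := reflTransGen_of_cycle s t T (∑ k, M.adjugate i k • h k)
      (graphBoundary_sum_smul s t _ h hker) (φ i)
      (by rw [hval]; simpa using hdet)
      (by
        intro x hx hne
        obtain ⟨j, rfl⟩ := hT x hx
        have hij : i ≠ j := fun hij => hne (hij ▸ rfl)
        rw [hval, Matrix.one_apply_ne hij, mul_zero])
    obtain ⟨g, hgT, hgb⟩ := exists_flow_of_reflTransGen s t T hwalk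
    have hmem := hspan (g + Pi.single (φ i) 1) (by
      rw [graphBoundary_add, hgb, graphBoundary_single]
      abel)
    obtain ⟨c, hc⟩ := (Submodule.mem_span_range_iff_exists_fun ℤ).1 hmem
    refine ⟨c, fun j => ?_⟩
    have := congrFun hc (φ j)
    simpa [hM, hgT _ (hφT j), Pi.single_apply, hφ.eq_iff, Matrix.one_apply, eq_comm] using this
  choose c hc using hcycle
  have hmul : Matrix.of c * M = 1 := by
    ext i j
    simpa [Matrix.mul_apply] using hc i j
  have := congrArg Matrix.det hmul
  rw [Matrix.det_mul, Matrix.det_one] at this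
  exact IsUnit.of_mul_eq_one_right _ this

theorem graphPoly_eq_sum {E : Type*} [Fintype E] [DecidableEq E] {r : ℕ}
    (h : Fin r → (E → ℤ)) :
    graphPoly h = ∑ φ : Fin r → E, monomial (∑ i, Finsupp.single (φ i) 1)
      ((∏ i, h i (φ i)) * (Matrix.of fun i j => h j (φ i)).det) := by
  have hrow : (Matrix.of fun i j : Fin r => ∑ e : E, (X e : MvPolynomial E ℤ) * C (h i e * h j e))
      = fun i => ∑ e : E, (X e * C (h i e) : MvPolynomial E ℤ) • fun j => C (h j e) := by
    funext i j
    simp [Finset.sum_apply, mul_assoc]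
  rw [graphPoly, hrow]
  change Matrix.detRowAlternating.toMultilinearMap _ = _
  rw [MultilinearMap.map_sum]
  refine Finset.sum_congr rfl fun φ _ => ?_
  rw [MultilinearMap.map_smul_univ]
  have hdet : Matrix.detRowAlternating.toMultilinearMap
      (fun i j => (C (h j (φ i)) : MvPolynomial E ℤ)) =
      C (Matrix.of fun i j => h j (φ i)).det := by
    rw [RingHom.map_det]
    rfl
  have hmon : (monomial (∑ i, Finsupp.single (φ i) 1) (1 : ℤ)) = ∏ i, X (φ i) := by
    rw [monomial_sum_one]
    rfl
  rw [hdet, Finset.prod_mul_distrib, ← map_prod, smul_eq_mul, mul_assoc, ← map_mul, mul_comm,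
    ← hmon, C_mul_monomial, mul_one]

theorem coeff_graphPoly {E : Type*} [Fintype E] [DecidableEq E] {r : ℕ}
    (h : Fin r → (E → ℤ)) (d : E →₀ ℕ) :
    coeff d (graphPoly h) = ∑ φ : Fin r → E, if ∑ i, Finsupp.single (φ i) 1 = d then
      (∏ i, h i (φ i)) * (Matrix.of fun i j => h j (φ i)).det else 0 := by
  rw [graphPoly_eq_sum, coeff_sum]
  exact Finset.sum_congr rfl fun φ _ => coeff_monomial _ _ _

theorem det_of_not_injective {E : Type*} {r : ℕ} (h : Fin r → (E → ℤ)) (φ : Fin r → E)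
    (hφ : ¬ Function.Injective φ) : (Matrix.of fun i j => h j (φ i)).det = 0 := by
  obtain ⟨i, j, hij, hne⟩ := Function.not_injective_iff.1 hφ
  exact Matrix.det_zero_of_row_eq hne (by funext k; simp [hij])

theorem exists_perm_of_sum_single_eq {E : Type*} [DecidableEq E] {r : ℕ} {φ ψ : Fin r → E}
    (hψ : Function.Injective ψ)
    (heq : ∑ i, Finsupp.single (ψ i) 1 = ∑ i, (Finsupp.single (φ i) 1 : E →₀ ℕ)) :
    ∃ σ : Equiv.Perm (Fin r), φ ∘ σ = ψ := by
  have hmem : ∀ i, ∃ j, φ j = ψ i := by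
    intro i
    by_contra! hne
    have := DFunLike.congr_fun heq (ψ i)
    simp [Finsupp.finsetSum_apply, Finsupp.single_apply, hne, hψ.eq_iff] at this
  choose σ hσ using hmem
  have hinj : Function.Injective σ := fun a b hab => hψ (by rw [← hσ a, ← hσ b, hab])
  exact ⟨Equiv.ofBijective σ (Finite.injective_iff_bijective.1 hinj), funext hσ⟩

/-- The coefficient of the squarefree monomial on the edges `φ 1, …, φ r` is the square of the
corresponding minor. -/
theorem coeff_graphPoly_of_injective {E : Type*} [Fintype E] [DecidableEq E] {r : ℕ}
    (h : Fin r → (E → ℤ)) (φ : Fin r → E) (hφ : Function.Injective φ) :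
    coeff (∑ i, Finsupp.single (φ i) 1) (graphPoly h) =
      (Matrix.of fun i j => h i (φ j)).det ^ 2 := by
  set M : Matrix (Fin r) (Fin r) ℤ := Matrix.of fun i j => h i (φ j) with hM
  have hsum : ∑ σ : Equiv.Perm (Fin r),
      (∏ i, h i (φ (σ i))) * ((Equiv.Perm.sign σ : ℤ) * M.det) = M.det ^ 2 := by
    have hdet : M.det = ∑ σ : Equiv.Perm (Fin r),
        (Equiv.Perm.sign σ : ℤ) * ∏ i, M i (σ i) := by
      rw [← Matrix.det_transpose, Matrix.det_apply']
      rfl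
    rw [sq]
    nth_rewrite 2 [hdet]
    rw [Finset.sum_mul]
    refine Finset.sum_congr rfl fun σ _ => ?_
    simp only [hM, Matrix.of_apply]
    ring
  rw [coeff_graphPoly, ← hsum]
  symm
  refine Finset.sum_of_injOn (fun σ => φ ∘ σ) ?_ (by simp) ?_ ?_
  · intro σ _ τ _ hστ
    exact Equiv.ext fun i => hφ (congrFun hστ i)
  · intro ψ _ hψ
    split_ifs with heq
    · by_cases hinj : Function.Injective ψ
      · obtain ⟨σ, hσ⟩ := exists_perm_of_sum_single_eq hinj heq
        exact absurd ⟨σ, by simp, hσ⟩ hψ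
      · rw [det_of_not_injective h ψ hinj, mul_zero]
    · rfl
  · intro σ _
    have hperm : (Matrix.of fun i j => h j ((φ ∘ σ) i)).det = (Equiv.Perm.sign σ : ℤ) * M.det := by
      rw [← Matrix.det_transpose M]
      exact Matrix.det_permute σ M.transpose
    rw [hperm, if_pos]
    · rfl
    · exact Equiv.sum_comp σ fun i => Finsupp.single (φ i) 1

/-- Corollary 1.2.4: for a finite connected directed multigraph `Γ` and a `ℤ`-basis
`h₁,…,h_r` of `H₁(Γ,ℤ) = ker ∂`, every coefficient of the graph polynomial
`Ψ_Γ = det(Σ_e A_e M_e)` is either `0` or `1`. -/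
theorem graphPoly_coeff_zero_or_one {E V : Type*}
    [Fintype E] [Fintype V] [DecidableEq E] [DecidableEq V] [Nonempty V]
    (s t : E → V)
    (hconn : ∀ u v : V, Relation.ReflTransGen (EdgeStep s t Finset.univ) u v)
    (r : ℕ) (h : Fin r → (E → ℤ))
    (hker : ∀ i, graphBoundary s t (h i) = 0)
    (hspan : ∀ f : E → ℤ, graphBoundary s t f = 0 →
      f ∈ Submodule.span ℤ (Set.range h))
    (hindep : LinearIndependent ℤ h) :
    ∀ d : E →₀ ℕ, MvPolynomial.coeff d (graphPoly h) = 0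
      ∨ MvPolynomial.coeff d (graphPoly h) = 1 := by
  intro d
  by_cases hd : ∃ φ : Fin r → E, Function.Injective φ ∧ ∑ i, Finsupp.single (φ i) 1 = d
  · obtain ⟨φ, hφ, rfl⟩ := hd
    rw [coeff_graphPoly_of_injective h φ hφ]
    refine (det_cycles_eq_zero_or_isUnit s t h hker hspan φ hφ).imp (fun h0 => ?_) fun h1 => ?_
    · rw [h0, sq, zero_mul]
    · rcases Int.isUnit_iff.1 h1 with h1 | h1 <;> rw [h1] <;> norm_num
  · left
    rw [coeff_graphPoly]
    refine Finset.sum_eq_zero fun φ _ => ?_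
    split_ifs with heq
    · rw [det_of_not_injective h φ fun hφ => hd ⟨φ, hφ, heq⟩, mul_zero]
    · rfl
end

section
/- For every n ≥ 3, the wheel with n spokes WS_n is primitively log divergent; it has 2n edges and first Betti number h₁(WS_n) = n. -/
/-- The first Betti number `h₁(G) = |E(G)| − |V(G)| + c(G)` of a finite simple graph. -/
noncomputable def betti {V : Type*} (G : SimpleGraph V) : ℤ :=
  (Nat.card G.edgeSet : ℤ) - (Nat.card V : ℤ) + (Nat.card G.ConnectedComponent : ℤ)

/-- The set of endpoints of the edges in `F`. -/
def edgeSupport {V : Type*} (F : Set (Sym2 V)) : Set V := {v : V | ∃ e ∈ F, v ∈ e}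

/-- The subgraph spanned by a set of edges `F`: its edge set is `F` and its vertex set
is the set of endpoints of edges in `F`. -/
def spannedSubgraph {V : Type*} (F : Set (Sym2 V)) : SimpleGraph (edgeSupport F) :=
  (SimpleGraph.fromEdgeSet F).induce (edgeSupport F)

/-- `h₁(G_F) = |F| − |V(G_F)| + c(G_F)` for the subgraph spanned by `F`. -/
noncomputable def bettiOfEdges {V : Type*} (F : Set (Sym2 V)) : ℤ :=
  (Nat.card F : ℤ) - (Nat.card (edgeSupport F) : ℤ)
    + (Nat.card (spannedSubgraph F).ConnectedComponent : ℤ)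

/-- The subgraph spanned by `F` is convergent: `|E| > 2·h₁`. -/
def ConvergentEdges {V : Type*} (F : Set (Sym2 V)) : Prop :=
  2 * bettiOfEdges F < (Nat.card F : ℤ)

/-- A graph is logarithmically divergent if `|E(G)| = 2·h₁(G)`. -/
def LogDivergent {V : Type*} (G : SimpleGraph V) : Prop :=
  (Nat.card G.edgeSet : ℤ) = 2 * betti G

/-- A graph is primitively log divergent if it is logarithmically divergent and the
subgraph spanned by every nonempty proper subset of its edges which is connected is
convergent. -/
def PrimLogDivergent {V : Type*} (G : SimpleGraph V) : Prop :=
  LogDivergent G ∧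
    ∀ F : Set (Sym2 V), F ⊆ G.edgeSet → F.Nonempty → F ≠ G.edgeSet →
      (spannedSubgraph F).Connected → ConvergentEdges F

/-- The successor of a rim index, cyclically (`i ↦ i+1 mod n`). -/
def rimNext {n : ℕ} (i : Fin n) : Fin n := ⟨((i : ℕ) + 1) % n, Nat.mod_lt _ i.pos⟩

/-- The wheel with `n` spokes `WS_n`: vertex `0` is the hub, the vertices `1,…,n` lie
on the rim; the edges are the spokes `v₀ v_i` and the rim edges `v_i v_{i+1}`
(indices mod `n`). -/
def wheel (n : ℕ) : SimpleGraph (Fin (n+1)) :=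
  SimpleGraph.fromEdgeSet
    {e : Sym2 (Fin (n+1)) |
      (∃ i : Fin n, e = s((0 : Fin (n+1)), i.succ)) ∨
      (∃ i : Fin n, e = s(i.succ, (rimNext i).succ))}

/-- The spoke of the wheel ending at the rim vertex of index `i`. -/
def spokeEdge {n : ℕ} (i : Fin n) : Sym2 (Fin (n + 1)) := s(0, i.succ)

/-- The rim edge of the wheel starting at the rim vertex of index `i`. -/
def rimEdge {n : ℕ} (i : Fin n) : Sym2 (Fin (n + 1)) := s(i.succ, (rimNext i).succ)

theorem rimNext_val {n : ℕ} (i : Fin n) :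
    (rimNext i : ℕ) = if (i : ℕ) + 1 = n then 0 else (i : ℕ) + 1 := by
  have hi := i.isLt
  simp only [rimNext]
  split_ifs with h
  · simp [h]
  · exact Nat.mod_eq_of_lt (by omega)

theorem rimNext_ne {n : ℕ} (hn : 3 ≤ n) (i : Fin n) : rimNext i ≠ i := by
  intro h
  have h1 := rimNext_val i
  rw [h] at h1
  split_ifs at h1 <;> omega

theorem rimNext_rimNext_ne {n : ℕ} (hn : 3 ≤ n) (i : Fin n) : rimNext (rimNext i) ≠ i := by
  intro h
  have h1 := rimNext_val i
  have h2 := rimNext_val (rimNext i)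
  rw [h] at h2
  split_ifs at h1 h2 <;> omega

/-- The cyclic successor acts transitively on the rim. -/
theorem eq_univ_of_rimNext_mem {n : ℕ} {R : Finset (Fin n)} (hne : R.Nonempty)
    (h : ∀ i ∈ R, rimNext i ∈ R) : R = Finset.univ := by
  obtain ⟨i, hi⟩ := hne
  have up : ∀ k (hk : k < n) (j : Fin n), j ∈ R → (j : ℕ) ≤ k → (⟨k, hk⟩ : Fin n) ∈ R := by
    intro k
    induction k with
    | zero =>
      intro hk j hj hjk
      convert hj
      omega
    | succ k ih =>
      intro hk j hj hjk
      rcases Nat.lt_or_ge k j with hlt | hle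
      · convert hj
        omega
      · convert h _ (ih (by omega) j hj hle) using 1
        ext
        rw [rimNext_val]
        simp only
        split_ifs <;> omega
  have hpos : 0 < n := i.pos
  have hlast := up (n - 1) (by omega) i hi (by omega)
  have hzero : (⟨0, hpos⟩ : Fin n) ∈ R := by
    convert h _ hlast using 1
    ext
    rw [rimNext_val]
    simp only
    split_ifs <;> omega
  exact Finset.eq_univ_of_forall fun j => up j j.isLt _ hzero (Nat.zero_le _)

theorem spokeEdge_injective {n : ℕ} : Function.Injective (spokeEdge (n := n)) := by
  intro i j h
  simpa [spokeEdge] using h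

theorem rimEdge_injective {n : ℕ} (hn : 3 ≤ n) : Function.Injective (rimEdge (n := n)) := by
  intro i j h
  simp only [rimEdge, Sym2.eq_iff, Fin.succ_inj] at h
  rcases h with h | ⟨h1, h2⟩
  · exact h.1
  · rw [h1] at h2
    exact absurd h2 (rimNext_rimNext_ne hn j)

theorem spokeEdge_ne_rimEdge {n : ℕ} (i j : Fin n) : spokeEdge i ≠ rimEdge j := by
  intro h
  simp only [spokeEdge, rimEdge, Sym2.eq_iff] at h
  rcases h with h | h
  · exact Fin.succ_ne_zero _ h.1.symm
  · exact Fin.succ_ne_zero _ h.1.symm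

theorem mem_edgeSet_wheel {n : ℕ} (hn : 3 ≤ n) (e : Sym2 (Fin (n + 1))) :
    e ∈ (wheel n).edgeSet ↔ (∃ i : Fin n, e = spokeEdge i) ∨ ∃ i : Fin n, e = rimEdge i := by
  rw [wheel, SimpleGraph.edgeSet_fromEdgeSet]
  refine ⟨fun h => h.1, fun h => ⟨h, ?_⟩⟩
  rcases h with ⟨i, rfl⟩ | ⟨i, rfl⟩
  · simpa [spokeEdge] using (Fin.succ_ne_zero i).symm
  · simpa [rimEdge] using (rimNext_ne hn i).symm

/-- A set of edges of the wheel is counted by its spokes and its rim edges. -/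
theorem card_edges_eq {n : ℕ} (hn : 3 ≤ n) {F : Set (Sym2 (Fin (n + 1)))}
    (hF : F ⊆ (wheel n).edgeSet) {S R : Finset (Fin n)} (hS : ∀ i, i ∈ S ↔ spokeEdge i ∈ F)
    (hR : ∀ i, i ∈ R ↔ rimEdge i ∈ F) : Nat.card F = S.card + R.card := by
  have hFeq : F = ↑(S.image spokeEdge ∪ R.image rimEdge) := by
    ext e
    simp only [Finset.coe_union, Finset.coe_image, Set.mem_union, Set.mem_image, Finset.mem_coe]
    constructor
    · intro he
      rcases (mem_edgeSet_wheel hn e).1 (hF he) with ⟨i, rfl⟩ | ⟨i, rfl⟩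
      · exact Or.inl ⟨i, (hS i).2 he, rfl⟩
      · exact Or.inr ⟨i, (hR i).2 he, rfl⟩
    · rintro (⟨i, hi, rfl⟩ | ⟨i, hi, rfl⟩)
      · exact (hS i).1 hi
      · exact (hR i).1 hi
  have hdisj : Disjoint (S.image spokeEdge) (R.image rimEdge) := by
    rw [Finset.disjoint_left]
    intro e he he'
    obtain ⟨i, -, rfl⟩ := Finset.mem_image.1 he
    obtain ⟨j, -, hj⟩ := Finset.mem_image.1 he'
    exact spokeEdge_ne_rimEdge i j hj.symm
  rw [Nat.card_coe_set_eq, hFeq, Set.ncard_coe_finset, Finset.card_union_of_disjoint hdisj,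
    Finset.card_image_of_injective _ spokeEdge_injective,
    Finset.card_image_of_injective _ (rimEdge_injective hn)]

theorem card_edgeSet_wheel {n : ℕ} (hn : 3 ≤ n) : Nat.card (wheel n).edgeSet = 2 * n := by
  rw [card_edges_eq hn subset_rfl (S := Finset.univ) (R := Finset.univ)]
  · simp [two_mul]
  · exact fun i => by simpa using (mem_edgeSet_wheel hn _).2 (Or.inl ⟨i, rfl⟩)
  · exact fun i => by simpa using (mem_edgeSet_wheel hn _).2 (Or.inr ⟨i, rfl⟩)

theorem card_connectedComponent_of_connected {V : Type*} {G : SimpleGraph V}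
    (h : G.Connected) : Nat.card G.ConnectedComponent = 1 := by
  have := h.nonempty
  have := h.preconnected.subsingleton_connectedComponent
  exact Nat.card_unique

theorem wheel_connected {n : ℕ} (hn : 3 ≤ n) : (wheel n).Connected := by
  have hub : ∀ v, (wheel n).Reachable 0 v := by
    intro v
    induction v using Fin.cases with
    | zero => exact SimpleGraph.Reachable.refl 0
    | succ i =>
      refine SimpleGraph.Adj.reachable ?_
      rw [← SimpleGraph.mem_edgeSet]
      exact (mem_edgeSet_wheel hn _).2 (Or.inl ⟨i, rfl⟩)
  exact { preconnected := fun u v => (hub u).symm.trans (hub v), nonempty := ⟨0⟩ }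

theorem betti_wheel {n : ℕ} (hn : 3 ≤ n) : betti (wheel n) = (n : ℤ) := by
  rw [betti, card_edgeSet_wheel hn, card_connectedComponent_of_connected (wheel_connected hn),
    Nat.card_fin]
  push_cast
  ring

/-- A nonempty proper set of edges of the wheel has at most `2 * m - 3` elements, where `m` is
the number of its endpoints. -/
theorem card_edges_add_three_le {n : ℕ} (hn : 3 ≤ n) {F : Set (Sym2 (Fin (n + 1)))}
    (hF : F ⊆ (wheel n).edgeSet) (hne : F.Nonempty) (hproper : F ≠ (wheel n).edgeSet) :
    Nat.card F + 3 ≤ 2 * Nat.card (edgeSupport F) := by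
  classical
  set S : Finset (Fin n) := {i | spokeEdge i ∈ F} with hSdef
  set R : Finset (Fin n) := {i | rimEdge i ∈ F} with hRdef
  have hS : ∀ i, i ∈ S ↔ spokeEdge i ∈ F := by simp [hSdef]
  have hR : ∀ i, i ∈ R ↔ rimEdge i ∈ F := by simp [hRdef]
  have hcard := card_edges_eq hn hF hS hR
  set U : Finset (Fin n) := S ∪ R ∪ R.image rimNext with hU
  have hSU : S ⊆ U := fun i hi => by simp [hU, hi]
  have hRU : R ⊆ U := fun i hi => by simp [hU, hi]
  have hnextU : ∀ i ∈ R, rimNext i ∈ U := fun i hi =>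
    Finset.mem_union_right _ (Finset.mem_image_of_mem _ hi)
  have hsupp : ∀ i ∈ U, i.succ ∈ edgeSupport F := by
    intro i hi
    simp only [hU, Finset.mem_union, Finset.mem_image] at hi
    rcases hi with (hi | hi) | ⟨j, hj, rfl⟩
    · exact ⟨_, (hS i).1 hi, Sym2.mem_mk_right _ _⟩
    · exact ⟨_, (hR i).1 hi, Sym2.mem_mk_left _ _⟩
    · exact ⟨_, (hR j).1 hj, Sym2.mem_mk_right _ _⟩
  have hSc := Finset.card_le_card hSU
  have hRc := Finset.card_le_card hRU
  have hRuniv : R.Nonempty → R = U → R = Finset.univ := fun hRne h =>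
    eq_univ_of_rimNext_mem hRne fun i hi => by rw [h]; exact hnextU i hi
  have hUle : U.card ≤ Nat.card (edgeSupport F) := by
    rw [Nat.card_coe_set_eq, ← Finset.card_image_of_injective U (Fin.succ_injective n),
      ← Set.ncard_coe_finset]
    refine Set.ncard_le_ncard ?_ (Set.toFinite _)
    intro v hv
    obtain ⟨i, hi, rfl⟩ := Finset.mem_image.1 (Finset.mem_coe.1 hv)
    exact hsupp i hi
  rcases S.eq_empty_or_nonempty with hSe | ⟨s, hs⟩
  · have hRne : R.Nonempty := by
      obtain ⟨e, he⟩ := hne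
      rcases (mem_edgeSet_wheel hn e).1 (hF he) with ⟨i, rfl⟩ | ⟨i, rfl⟩
      · exact absurd ((hS i).2 he) (by simp [hSe])
      · exact ⟨i, (hR i).2 he⟩
    have hRpos := hRne.card_pos
    rw [hSe, Finset.card_empty] at hcard
    by_cases hRU' : R = U
    · have hRn : R.card = n := by rw [hRuniv hRne hRU', Finset.card_fin]
      omega
    · have := Finset.card_lt_card (hRU.ssubset_of_ne hRU')
      omega
  · have hVle : U.card + 1 ≤ Nat.card (edgeSupport F) := by
      have h0 : (0 : Fin (n + 1)) ∉ U.image Fin.succ := by simp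
      rw [Nat.card_coe_set_eq, ← Finset.card_image_of_injective U (Fin.succ_injective n),
        ← Finset.card_insert_of_notMem h0, ← Set.ncard_coe_finset]
      refine Set.ncard_le_ncard ?_ (Set.toFinite _)
      intro v hv
      rcases Finset.mem_insert.1 (Finset.mem_coe.1 hv) with rfl | hv
      · exact ⟨_, (hS s).1 hs, Sym2.mem_mk_left _ _⟩
      · obtain ⟨i, hi, rfl⟩ := Finset.mem_image.1 hv
        exact hsupp i hi
    have hlt : S.card + R.card < 2 * U.card := by
      by_contra hge
      have hSU' : S = U := Finset.eq_of_subset_of_card_le hSU (by omega)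
      have hRU' : R = U := Finset.eq_of_subset_of_card_le hRU (by omega)
      have hRu := hRuniv ⟨s, hRU' ▸ hSU hs⟩ hRU'
      have hSu : S = Finset.univ := by rw [hSU', ← hRU', hRu]
      refine hproper (hF.antisymm fun e he => ?_)
      rcases (mem_edgeSet_wheel hn e).1 he with ⟨i, rfl⟩ | ⟨i, rfl⟩
      · exact (hS i).1 (hSu ▸ Finset.mem_univ i)
      · exact (hR i).1 (hRu ▸ Finset.mem_univ i)
    omega

/-- For every `n ≥ 3`, the wheel with `n` spokes `WS_n` is primitively log divergent;
it has `2n` edges and first Betti number `h₁(WS_n) = n`. -/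
theorem wheel_primLogDivergent (n : ℕ) (hn : 3 ≤ n) :
    PrimLogDivergent (wheel n) ∧
    Nat.card (wheel n).edgeSet = 2 * n ∧
    betti (wheel n) = (n : ℤ) := by
  refine ⟨⟨?_, fun F hF hne hproper hconn => ?_⟩, card_edgeSet_wheel hn, betti_wheel hn⟩
  · rw [LogDivergent, card_edgeSet_wheel hn, betti_wheel hn]
    push_cast
    rfl
  · have h := card_edges_add_three_le hn hF hne hproper
    rw [ConvergentEdges, bettiOfEdges, card_connectedComponent_of_connected hconn]
    omega
end
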